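/- arXiv:quant-ph/9512024 — 5 statements merged into one kernel-verified Lean document; each statement's English description precedes it below -/
import Mathlib

section
/- Let B be a Boolean algebra and d a decoherence functional on B such that B is preconsistent with respect to d and d(⊤,⊤) ≠ 0. Define p(a) := d(a,a)/d(⊤,⊤) for a ∈ B (a nonnegative real number). Then p is a finitely additive probability measure on B: p(⊥) = 0, p(⊤) = 1, p(a) ≥ 0 for every a ∈ B, and p(a ⊔ b) = p(a) + p(b) whenever a ⊓ b = ⊥. -/
open scoped ComplexOrder
/-- If a Boolean algebra `B` is preconsistent with respect to a decoherence
functional `d` with `d ⊤ ⊤ ≠ 0`, then `p a := d a a / d ⊤ ⊤` is a finitely additive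
probability measure on `B`. -/
theorem decoherence_probability_measure {B : Type*} [BooleanAlgebra B] (d : B → B → ℂ)
    (hpos : ∀ a : B, 0 ≤ d a a)
    (hconj : ∀ a b : B, d a b = starRingEnd ℂ (d b a))
    (hadd : ∀ a b c : B, a ⊓ b = ⊥ → d (a ⊔ b) c = d a c + d b c)
    (hpre : ∀ a b : B, a ⊓ b = ⊥ → (d a b).re = 0)
    (hne : d ⊤ ⊤ ≠ 0) :
    let p : B → ℝ := fun a => (d a a).re / (d ⊤ ⊤).re
    p ⊥ = 0 ∧ p ⊤ = 1 ∧ (∀ a : B, 0 ≤ p a) ∧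
      (∀ a b : B, a ⊓ b = ⊥ → p (a ⊔ b) = p a + p b) := by
  have hre_symm : ∀ a b : B, (d a b).re = (d b a).re := fun a b => by
    rw [hconj a b, Complex.conj_re]
  have hre_nonneg : ∀ a : B, 0 ≤ (d a a).re := fun a => (Complex.nonneg_iff.mp (hpos a)).1
  have htop : (d ⊤ ⊤).re ≠ 0 := fun h =>
    hne (Complex.ext h (Complex.nonneg_iff.mp (hpos ⊤)).2.symm)
  intro p
  refine ⟨?_, div_self htop, fun a => div_nonneg (hre_nonneg a) (hre_nonneg ⊤), ?_⟩
  · simp only [p, hpre ⊥ ⊥ (inf_idem ⊥), zero_div]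
  · intro a b hab
    have hba : b ⊓ a = ⊥ := inf_comm a b ▸ hab
    simp only [p]
    rw [← add_div, hadd a b (a ⊔ b) hab, Complex.add_re, hre_symm a (a ⊔ b),
      hre_symm b (a ⊔ b), hadd a b a hab, hadd a b b hab, Complex.add_re, Complex.add_re,
      hpre a b hab, hpre b a hba, add_zero, zero_add]
end

section
/- Let B be a Boolean algebra and d a decoherence functional on B such that B is preconsistent with respect to d and d(⊤,⊤) ≠ 0, and set p(a) := d(a,a)/d(⊤,⊤). Then for all a,b ∈ B: (1) 0 ≤ p(a) ≤ 1; (2) p(a ⊔ b) + p(a ⊓ b) = p(a) + p(b); (3) if a ≤ b then p(a) ≤ p(b). -/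
open scoped ComplexOrder

/-- For a preconsistent decoherence functional, the diagonal `a ↦ Re d a a` is additive on
disjoint elements: the interference terms vanish. -/
theorem re_diag_sup_of_disjoint {B : Type*} [BooleanAlgebra B] {d : B → B → ℂ}
    (hconj : ∀ a b : B, d a b = starRingEnd ℂ (d b a))
    (hadd : ∀ a b c : B, a ⊓ b = ⊥ → d (a ⊔ b) c = d a c + d b c)
    (hpre : ∀ a b : B, a ⊓ b = ⊥ → (d a b).re = 0)
    {a b : B} (h : a ⊓ b = ⊥) :
    (d (a ⊔ b) (a ⊔ b)).re = (d a a).re + (d b b).re := by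
  have hadd_right (c : B) : (d c (a ⊔ b)).re = (d c a).re + (d c b).re := by
    rw [hconj c (a ⊔ b), hadd a b c h, hconj c a, hconj c b]
    simp
  rw [hadd a b _ h, Complex.add_re, hadd_right, hadd_right, hpre a b h,
    hpre b a (inf_comm a b ▸ h)]
  ring

/-- For a Boolean algebra `B` preconsistent with respect to a decoherence
functional `d` with `d ⊤ ⊤ ≠ 0`, the functional `p a := d a a / d ⊤ ⊤` satisfies
`0 ≤ p a ≤ 1`, the modularity identity `p (a ⊔ b) + p (a ⊓ b) = p a + p b`, and is monotone. -/
theorem decoherence_probability_properties {B : Type*} [BooleanAlgebra B] (d : B → B → ℂ)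
    (hpos : ∀ a : B, 0 ≤ d a a)
    (hconj : ∀ a b : B, d a b = starRingEnd ℂ (d b a))
    (hadd : ∀ a b c : B, a ⊓ b = ⊥ → d (a ⊔ b) c = d a c + d b c)
    (hpre : ∀ a b : B, a ⊓ b = ⊥ → (d a b).re = 0)
    (hne : d ⊤ ⊤ ≠ 0) :
    let p : B → ℝ := fun a => (d a a).re / (d ⊤ ⊤).re
    ∀ a b : B,
      (0 ≤ p a ∧ p a ≤ 1) ∧
      p (a ⊔ b) + p (a ⊓ b) = p a + p b ∧
      (a ≤ b → p a ≤ p b) := by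
  intro p
  have hre (a : B) : 0 ≤ (d a a).re := (Complex.nonneg_iff.mp (hpos a)).1
  have hp_nonneg (a : B) : 0 ≤ p a := div_nonneg (hre a) (hre ⊤)
  have hp_add {a b : B} (h : a ⊓ b = ⊥) : p (a ⊔ b) = p a + p b := by
    simp only [p, re_diag_sup_of_disjoint hconj hadd hpre h, add_div]
  have hp_mono {a b : B} (h : a ≤ b) : p a ≤ p b := by
    have key := hp_add (inf_sdiff_self_right : a ⊓ (b \ a) = ⊥)
    rw [sup_sdiff_cancel_right h] at key
    linarith [hp_nonneg (b \ a)]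
  have hp_top : p ⊤ ≤ 1 := div_self_le_one _
  refine fun a b => ⟨⟨hp_nonneg a, (hp_mono le_top).trans hp_top⟩, ?_, hp_mono⟩
  have hsup := hp_add (inf_sdiff_self_right : a ⊓ (b \ a) = ⊥)
  have hinf := hp_add (inf_inf_sdiff b a)
  rw [sup_sdiff_self_right] at hsup
  rw [sup_inf_sdiff, inf_comm b a] at hinf
  linarith
end

section
/- Let B be a Boolean algebra and d a decoherence functional on B. Then B is preconsistent with respect to d if and only if for every pair a,b ∈ B one has d(a ⊔ b, a ⊔ b) + d(a ⊓ b, a ⊓ b) = d(a,a) + d(b,b). -/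
open scoped ComplexOrder

/-- A biadditive Hermitian form on disjoint elements expands on the diagonal with twice the
real part of the cross term. -/
theorem diagonal_sup_of_inf_eq_bot {B : Type*} [BooleanAlgebra B] (d : B → B → ℂ)
    (hconj : ∀ a b : B, d a b = starRingEnd ℂ (d b a))
    (hadd : ∀ a b c : B, a ⊓ b = ⊥ → d (a ⊔ b) c = d a c + d b c)
    {a b : B} (hab : a ⊓ b = ⊥) :
    d (a ⊔ b) (a ⊔ b) = d a a + d b b + 2 * ((d a b).re : ℂ) := by
  have hright (c : B) : d c (a ⊔ b) = d c a + d c b := by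
    rw [hconj, hadd a b c hab, map_add, ← hconj, ← hconj]
  have hcross : d a b + d b a = 2 * ((d a b).re : ℂ) := by
    rw [hconj b a, Complex.add_conj]
    push_cast
    rfl
  rw [hadd a b _ hab, hright, hright, ← hcross]
  ring

/-- A Boolean algebra `B` is preconsistent with respect to a decoherence
functional `d` if and only if `d (a ⊔ b) (a ⊔ b) + d (a ⊓ b) (a ⊓ b) = d a a + d b b`
holds for every pair `a b : B`. -/
theorem preconsistent_iff_diagonal_modularity {B : Type*} [BooleanAlgebra B] (d : B → B → ℂ)
    (hpos : ∀ a : B, 0 ≤ d a a)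
    (hconj : ∀ a b : B, d a b = starRingEnd ℂ (d b a))
    (hadd : ∀ a b c : B, a ⊓ b = ⊥ → d (a ⊔ b) c = d a c + d b c) :
    (∀ a b : B, a ⊓ b = ⊥ → (d a b).re = 0) ↔
      (∀ a b : B, d (a ⊔ b) (a ⊔ b) + d (a ⊓ b) (a ⊓ b) = d a a + d b b) := by
  have hdiag {a b : B} (hab : a ⊓ b = ⊥) := diagonal_sup_of_inf_eq_bot d hconj hadd hab
  constructor
  · intro h a b
    have hadditive {x y : B} (hxy : x ⊓ y = ⊥) : d (x ⊔ y) (x ⊔ y) = d x x + d y y := by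
      simp [hdiag hxy, h x y hxy]
    have hsup := hadditive (x := a) (y := b \ a) inf_sdiff_self_right
    have hb := hadditive (x := a ⊓ b) (y := b \ a)
      (by rw [inf_right_comm, inf_sdiff_self_right, bot_inf_eq])
    rw [sup_sdiff_self_right] at hsup
    rw [inf_comm a b, sup_inf_sdiff] at hb
    rw [hsup, hb, inf_comm a b]
    ring
  · intro h a b hab
    have hbot : d ⊥ ⊥ = 0 := by simpa using hadd ⊥ ⊥ ⊥ (bot_inf_eq ⊥)
    have hmod := h a b
    rw [hab, hbot, add_zero, hdiag hab] at hmod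
    simpa using hmod
end

section
/- Let A and B be effects on a complex Hilbert space H. Then the following are equivalent: (1) √A + √B ≤ 1 and (√A + √B)² = 1; (2) B = (1 − √A)². In other words, (1 − √A)² is the unique ⊕̃-complement of the effect A, where A ⊕̃ B := (√A + √B)² whenever √A + √B ≤ 1. -/
set_option synthInstance.maxHeartbeats 1000000

/-- for effects `A` and `B` on a complex Hilbert space, `√A + √B ≤ 1` together
with `(√A + √B)² = 1` holds if and only if `B = (1 - √A)²`; i.e. `(1 - √A)²` is the unique
`⊕̃`-complement of `A`, where `A ⊕̃ B := (√A + √B)²`. -/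
theorem effect_tilde_oplus_complement_unique {H : Type*} [NormedAddCommGroup H]
    [InnerProductSpace ℂ H] [CompleteSpace H]
    (A B : H →L[ℂ] H) (hA : 0 ≤ A ∧ A ≤ 1) (hB : 0 ≤ B ∧ B ≤ 1) :
    (CFC.sqrt A + CFC.sqrt B ≤ 1 ∧ (CFC.sqrt A + CFC.sqrt B) ^ 2 = 1) ↔
      B = (1 - CFC.sqrt A) ^ 2 := by
  have hA_le : CFC.sqrt A ≤ 1 := by
    simpa only [CFC.sqrt_one] using CFC.sqrt_le_sqrt A 1 hA.2
  constructor
  · rintro ⟨-, h⟩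
    have h_sum : CFC.sqrt A + CFC.sqrt B = 1 := by
      rw [← CFC.sqrt_sq (CFC.sqrt A + CFC.sqrt B)
        (add_nonneg (CFC.sqrt_nonneg A) (CFC.sqrt_nonneg B)), h, CFC.sqrt_one]
    rw [← h_sum, add_sub_cancel_left, CFC.sq_sqrt B hB.1]
  · intro h
    have h_sqrt : CFC.sqrt B = 1 - CFC.sqrt A := by
      rw [h, CFC.sqrt_sq _ (sub_nonneg.mpr hA_le)]
    rw [h_sqrt, add_sub_cancel]
    exact ⟨le_rfl, one_pow 2⟩
end

section
/- Let A, B, C be effects on a complex Hilbert space H with √A + √B + √C ≤ 1, and define A ⊕̃ B := (√A + √B)² whenever √A + √B ≤ 1. Then √((√A + √B)²) = √A + √B, both (A ⊕̃ B) ⊕̃ C and A ⊕̃ (B ⊕̃ C) are well-defined, and (A ⊕̃ B) ⊕̃ C = A ⊕̃ (B ⊕̃ C) = (√A + √B + √C)². (The partial operation ⊕̃ on effects is associative.) -/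
set_option synthInstance.maxHeartbeats 1000000

/-- associativity of the partial operation `A ⊕̃ B := (√A + √B)²` on effects:
if `√A + √B + √C ≤ 1`, then `√((√A + √B)²) = √A + √B`, both `(A ⊕̃ B) ⊕̃ C` and
`A ⊕̃ (B ⊕̃ C)` are well-defined, and both equal `(√A + √B + √C)²`. -/
theorem effect_tilde_oplus_assoc {H : Type*} [NormedAddCommGroup H]
    [InnerProductSpace ℂ H] [CompleteSpace H]
    (A B C : H →L[ℂ] H) (hA : 0 ≤ A ∧ A ≤ 1) (hB : 0 ≤ B ∧ B ≤ 1) (hC : 0 ≤ C ∧ C ≤ 1)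
    (hsum : CFC.sqrt A + CFC.sqrt B + CFC.sqrt C ≤ 1) :
    -- `A ⊕̃ B` and `B ⊕̃ C` are well-defined
    CFC.sqrt A + CFC.sqrt B ≤ 1 ∧ CFC.sqrt B + CFC.sqrt C ≤ 1 ∧
    -- the square root of a `⊕̃`-sum
    CFC.sqrt ((CFC.sqrt A + CFC.sqrt B) ^ 2) = CFC.sqrt A + CFC.sqrt B ∧
    -- `(A ⊕̃ B) ⊕̃ C` is well-defined
    CFC.sqrt ((CFC.sqrt A + CFC.sqrt B) ^ 2) + CFC.sqrt C ≤ 1 ∧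
    -- `A ⊕̃ (B ⊕̃ C)` is well-defined
    CFC.sqrt A + CFC.sqrt ((CFC.sqrt B + CFC.sqrt C) ^ 2) ≤ 1 ∧
    -- `(A ⊕̃ B) ⊕̃ C = (√A + √B + √C)²`
    (CFC.sqrt ((CFC.sqrt A + CFC.sqrt B) ^ 2) + CFC.sqrt C) ^ 2 =
      (CFC.sqrt A + CFC.sqrt B + CFC.sqrt C) ^ 2 ∧
    -- `A ⊕̃ (B ⊕̃ C) = (√A + √B + √C)²`
    (CFC.sqrt A + CFC.sqrt ((CFC.sqrt B + CFC.sqrt C) ^ 2)) ^ 2 =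
      (CFC.sqrt A + CFC.sqrt B + CFC.sqrt C) ^ 2 := by
  have hAB : CFC.sqrt ((CFC.sqrt A + CFC.sqrt B) ^ 2) = CFC.sqrt A + CFC.sqrt B :=
    CFC.sqrt_sq _ (add_nonneg (CFC.sqrt_nonneg A) (CFC.sqrt_nonneg B))
  have hBC : CFC.sqrt ((CFC.sqrt B + CFC.sqrt C) ^ 2) = CFC.sqrt B + CFC.sqrt C :=
    CFC.sqrt_sq _ (add_nonneg (CFC.sqrt_nonneg B) (CFC.sqrt_nonneg C))
  rw [hAB, hBC, ← add_assoc]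
  refine ⟨(le_add_of_nonneg_right (CFC.sqrt_nonneg C)).trans hsum, ?_, rfl, hsum, hsum, rfl, rfl⟩
  rw [add_assoc] at hsum
  exact (le_add_of_nonneg_left (CFC.sqrt_nonneg A)).trans hsum
end
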